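/- Let m ≥ 1, let x_1, …, x_m ∈ ℂ be distinct with Re x_j < 0 for all j and closed under complex conjugation, let d ∈ ℝ[X] with degree at most m be such that the pair (η, d) is strictly positive real, and let ν̂ ∈ ℝ[X] with deg ν̂ ≤ deg d and deg ν̂ ≤ m − 1. Define r̲̂ as the supremum of the set { −Re(ν̂(s)/d(s)) / Re(η(s)/d(s)) : s ∈ ℂ, Re s > 0 }. Then for every r̂ ∈ ℝ such that ν̂ + r̂·η is not the zero polynomial, the following are equivalent: (a) for every s ∈ ℂ with Re s > 0 one has ν̂(s) + r̂·η(s) ≠ 0 and Re( d(s)/(ν̂(s) + r̂·η(s)) ) ≥ 0 (i.e. the reciprocal rational function d/(ν̂ + r̂·η) is positive real); (b) r̂ ≥ r̲̂. -/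

import Mathlib

open Polynomial Finset

/-- A pair `(ν, d)` of real polynomials is strictly positive real if there exists `ε > 0`
such that for every `s ∈ ℂ` with `Re s > -ε` one has `d(s) ≠ 0` and `Re (ν(s)/d(s)) ≥ 0`. -/
def IsStrictPosReal (ν d : Polynomial ℝ) : Prop :=
  ∃ ε > (0 : ℝ), ∀ s : ℂ, -ε < s.re →
    (Polynomial.aeval s) d ≠ 0 ∧ 0 ≤ ((Polynomial.aeval s) ν / (Polynomial.aeval s) d).re

open Filter Topology Bornology Asymptotics

lemma isLittleO_aeval_cobounded {p q : Polynomial ℝ} (h : p.degree < q.degree) :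
    (fun s : ℂ => aeval s p) =o[cobounded ℂ] fun s => aeval s q := by
  have := isLittleO_cobounded_of_degree_lt (R := ℂ) (P := p.map (algebraMap ℝ ℂ))
    (Q := q.map (algebraMap ℝ ℂ)) (by simpa using h)
  simpa [eval_map_algebraMap] using this

lemma isBigO_aeval_cobounded {p q : Polynomial ℝ} (h : p.degree ≤ q.degree) :
    (fun s : ℂ => aeval s p) =O[cobounded ℂ] fun s => aeval s q := by
  have := isBigO_cobounded_of_degree_le (R := ℂ) (P := p.map (algebraMap ℝ ℂ))
    (Q := q.map (algebraMap ℝ ℂ)) (by simpa using h)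
  simpa [eval_map_algebraMap] using this

/-- The ray from the origin through a nonzero point tends to infinity. -/
lemma tendsto_ofReal_mul_cobounded {w : ℂ} (hw : w ≠ 0) :
    Tendsto (fun t : ℝ => (t : ℂ) * w) atTop (cobounded ℂ) := by
  rw [← tendsto_norm_atTop_iff_cobounded]
  simp only [norm_mul, Complex.norm_real]
  exact tendsto_norm_atTop_atTop.atTop_mul_const (norm_pos_iff.2 hw)

lemma tendsto_ofReal_atTop_cobounded : Tendsto (fun t : ℝ => (t : ℂ)) atTop (cobounded ℂ) := by
  simpa using tendsto_ofReal_mul_cobounded one_ne_zero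

/-- Along a ray, a polynomial is asymptotic to its leading monomial. -/
lemma tendsto_aeval_ofReal_mul_div_pow (q : Polynomial ℝ) {w : ℂ} (hw : w ≠ 0) :
    Tendsto (fun t : ℝ => aeval ((t : ℂ) * w) q / (t : ℂ) ^ q.natDegree) atTop
      (𝓝 (q.leadingCoeff * w ^ q.natDegree)) := by
  have hequiv := (isEquivalent_cobounded_leading_monomial (R := ℂ)
    (P := q.map (algebraMap ℝ ℂ))).comp_tendsto (tendsto_ofReal_mul_cobounded hw)
  have hdiv := hequiv.div (IsEquivalent.refl (u := fun t : ℝ => (t : ℂ) ^ q.natDegree))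
  refine (hdiv.congr_right ?_).symm.tendsto_nhds tendsto_const_nhds |>.congr ?_
  · filter_upwards [eventually_gt_atTop 0] with t ht
    have : (t : ℂ) ≠ 0 := by exact_mod_cast ht.ne'
    simp only [Function.comp_apply, Pi.div_apply, leadingCoeff_map, natDegree_map, mul_pow]
    field_simp
    rfl
  · intro t
    simp [eval_map_algebraMap]

/-- A real polynomial whose real part is bounded below near infinity in the open right half plane
has degree at most one. -/
lemma natDegree_le_one_of_re_aeval_ge {q : Polynomial ℝ} {c : ℝ}
    (h : ∀ᶠ s in cobounded ℂ, 0 < s.re → c ≤ (aeval s q).re) : q.natDegree ≤ 1 := by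
  by_contra! hn
  set n := q.natDegree with hn_def
  have hn0 : n ≠ 0 := by omega
  have key : ∀ w : ℂ, 0 < w.re → 0 ≤ ((q.leadingCoeff : ℂ) * w ^ n).re := by
    intro w hw
    have hw0 : w ≠ 0 := by rintro rfl; simp at hw
    have hlim := (Complex.continuous_re.tendsto _).comp (tendsto_aeval_ofReal_mul_div_pow q hw0)
    have hlow : Tendsto (fun t : ℝ => c / t ^ n) atTop (𝓝 0) :=
      (tendsto_pow_atTop hn0).const_div_atTop c
    refine le_of_tendsto_of_tendsto hlow hlim ?_
    filter_upwards [(tendsto_ofReal_mul_cobounded hw0).eventually h,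
      eventually_gt_atTop 0] with t ht ht0
    have hre := ht (by simpa using mul_pos ht0 hw)
    simp only [Function.comp_apply, ← hn_def]
    rw [← Complex.ofReal_pow, Complex.div_ofReal_re]
    gcongr
  have hlead : 0 < q.leadingCoeff := by
    have h1 : 0 ≤ q.leadingCoeff := by simpa using key 1 (by simp)
    refine h1.lt_of_ne' (leadingCoeff_ne_zero.2 ?_)
    rintro rfl
    simp [hn_def] at hn
  have hn2 : (2 : ℝ) ≤ n := by exact_mod_cast hn
  set θ : ℝ := 2 * Real.pi / 3 / n
  have hθ0 : 0 < θ := by positivity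
  have hθ : θ < Real.pi / 2 := by
    have := Real.pi_pos
    rw [div_lt_iff₀ (by linarith)]
    nlinarith
  have hpow : Complex.exp (θ * Complex.I) ^ n =
      Complex.exp ((2 * Real.pi / 3 : ℝ) * Complex.I) := by
    rw [← Complex.exp_nat_mul]
    congr 1
    have : (n : ℂ) ≠ 0 := by exact_mod_cast hn0
    simp only [θ]
    push_cast
    field_simp
  have hcos := key (Complex.exp (θ * Complex.I)) (by
    rw [Complex.exp_ofReal_mul_I_re]
    exact Real.cos_pos_of_mem_Ioo ⟨by linarith [Real.pi_pos], hθ⟩)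
  rw [hpow, Complex.re_ofReal_mul, Complex.exp_ofReal_mul_I_re] at hcos
  have hneg : Real.cos (2 * Real.pi / 3) < 0 :=
    Real.cos_neg_of_pi_div_two_lt_of_lt (by linarith [Real.pi_pos]) (by linarith [Real.pi_pos])
  nlinarith

/-- If a quotient of polynomials with `deg d ≤ deg p` has nonnegative real part on the half plane
`-ε < Re s`, then its real part is bounded away from zero near infinity in the closed right
half plane. -/
lemma eventually_le_re_div_of_nonneg {p d : Polynomial ℝ} (hd : d ≠ 0)
    (hdeg : d.degree ≤ p.degree)
    {ε : ℝ} (hε : 0 < ε)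
    (h : ∀ s : ℂ, -ε < s.re → aeval s d ≠ 0 ∧ 0 ≤ (aeval s p / aeval s d).re) :
    ∃ δ > 0, ∀ᶠ s in cobounded ℂ, 0 ≤ s.re → δ ≤ (aeval s p / aeval s d).re := by
  set q := p / d with hq_def
  have hdiv : d * q + p % d = p := EuclideanDomain.div_add_mod p d
  have hsmall : Tendsto (fun s : ℂ => aeval s (p % d) / aeval s d) (cobounded ℂ) (𝓝 0) :=
    (isLittleO_aeval_cobounded (degree_mod_lt p hd)).tendsto_div_nhds_zero
  have hsplit : ∀ s : ℂ, aeval s d ≠ 0 →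
      aeval s p / aeval s d = aeval s q + aeval s (p % d) / aeval s d := by
    intro s hs
    conv_lhs => rw [← hdiv]
    simp only [map_add, map_mul]
    field_simp
  have hrem : ∀ δ > 0, ∀ᶠ s : ℂ in cobounded ℂ, |(aeval s (p % d) / aeval s d).re| < δ := by
    intro δ hδ
    filter_upwards [hsmall.norm.eventually_lt_const (by simpa using hδ)] with s hs
    exact (Complex.abs_re_le_norm _).trans_lt hs
  have hq : ∀ δ > 0, ∀ᶠ s : ℂ in cobounded ℂ, -ε < s.re → -δ ≤ (aeval s q).re := by
    intro δ hδ
    filter_upwards [hrem δ hδ] with s hs hre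
    have h1 := h s hre
    have h2 := h1.2
    rw [hsplit s h1.1, Complex.add_re] at h2
    linarith [(abs_lt.1 hs).2]
  have hq1 : q.natDegree ≤ 1 := natDegree_le_one_of_re_aeval_ge
    ((hq 1 one_pos).mono fun s hs h0 => hs (by linarith))
  obtain ⟨a, b, hab⟩ := exists_eq_X_add_C_of_natDegree_le_one hq1
  have hre : ∀ s : ℂ, (aeval s q).re = a * s.re + b := by
    intro s
    rw [hab]
    simp
  have hq0 : q ≠ 0 := by
    rw [hq_def, Ne, Polynomial.div_eq_zero_iff hd]
    exact not_lt.2 hdeg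
  have ha : 0 ≤ a := by
    by_contra! ha
    have hlim : Tendsto (fun t : ℝ => a * t + b) atTop atBot :=
      tendsto_atBot_add_const_right _ _ (tendsto_id.const_mul_atTop_of_neg ha)
    obtain ⟨t, ht1, ht2, ht3⟩ := ((tendsto_ofReal_atTop_cobounded.eventually (hq 1 one_pos)).and
      ((eventually_gt_atTop 0).and (hlim.eventually_lt_atBot (-1)))).exists
    have := ht1 (by simp; linarith)
    rw [hre, Complex.ofReal_re] at this
    linarith
  have hb : a * (ε / 2) ≤ b := by
    have hline : Tendsto (fun t : ℝ => (⟨-(ε / 2), t⟩ : ℂ)) atTop (cobounded ℂ) := by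
      rw [← tendsto_norm_atTop_iff_cobounded]
      exact tendsto_atTop_mono (fun t => (le_abs_self t).trans
        (Complex.abs_im_le_norm ⟨-(ε / 2), t⟩)) tendsto_id
    refine le_of_forall_pos_le_add fun δ hδ => ?_
    obtain ⟨t, ht⟩ := (hline.eventually (hq δ hδ)).exists
    have := ht (by simp; linarith)
    rw [hre] at this
    simp only at this
    linarith
  have hb0 : 0 < b := by
    rcases ha.eq_or_lt with rfl | ha
    · refine lt_of_le_of_ne (by simpa using hb) ?_
      rintro rfl
      exact hq0 (by simpa using hab)
    · exact lt_of_lt_of_le (by positivity) hb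
  refine ⟨b / 2, by positivity, ?_⟩
  filter_upwards [hrem (b / 2) (by positivity)] with s hs hs0
  rw [hsplit s (h s (by linarith)).1, Complex.add_re, hre]
  have := mul_nonneg ha hs0
  linarith [(abs_lt.1 hs).1]

/-- An analytic function with nonnegative real part on a preconnected open set is constant or has
positive real part. -/
lemma eqOn_const_or_re_pos {f : ℂ → ℂ} {U : Set ℂ} (hf : AnalyticOnNhd ℂ f U)
    (hU : IsPreconnected U) (hUo : IsOpen U) (h : ∀ z ∈ U, 0 ≤ (f z).re) :
    (∃ w, ∀ z ∈ U, f z = w) ∨ ∀ z ∈ U, 0 < (f z).re := by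
  refine (hf.is_constant_or_isOpen hU).imp id fun hopen z hz => ?_
  have hsub : f '' U ⊆ {w : ℂ | 0 ≤ w.re} := by
    rintro _ ⟨y, hy, rfl⟩
    exact h y hy
  have hmem := interior_maximal hsub (hopen U subset_rfl hUo) ⟨z, hz, rfl⟩
  rwa [Complex.interior_setOfPred_le_re] at hmem

lemma analyticOnNhd_aeval_div (p d : Polynomial ℝ) {U : Set ℂ} (hd : ∀ s ∈ U, aeval s d ≠ 0) :
    AnalyticOnNhd ℂ (fun s => aeval s p / aeval s d) U := fun s hs =>
  (AnalyticAt.aeval_polynomial analyticAt_id p).div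
    (AnalyticAt.aeval_polynomial analyticAt_id d) (hd s hs)

/-- The real part of a strictly positive real quotient with `deg d ≤ deg p` is bounded away from
zero on the closed right half plane. -/
lemma IsStrictPosReal.exists_le_re {p d : Polynomial ℝ} (h : IsStrictPosReal p d)
    (hdeg : d.degree ≤ p.degree) :
    ∃ δ > 0, ∀ s : ℂ, 0 ≤ s.re → δ ≤ (aeval s p / aeval s d).re := by
  obtain ⟨ε, hε, h⟩ := h
  have hd : d ≠ 0 := by
    rintro rfl
    exact (h 0 (by simpa using hε)).1 (by simp)
  obtain ⟨δ, hδ, hinf⟩ := eventually_le_re_div_of_nonneg hd hdeg hε h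
  have hpos : ∀ s : ℂ, -ε < s.re → 0 < (aeval s p / aeval s d).re := by
    rcases eqOn_const_or_re_pos (U := {s : ℂ | -ε < s.re})
      (analyticOnNhd_aeval_div p d fun s hs => (h s hs).1)
      (convex_halfSpace_re_gt _).isPreconnected (isOpen_lt continuous_const Complex.continuous_re)
      (fun s hs => (h s hs).2) with ⟨w, hw⟩ | hpos
    · obtain ⟨t, ht, ht0⟩ := ((tendsto_ofReal_atTop_cobounded.eventually hinf).and
        (eventually_ge_atTop 0)).exists
      have h1 := ht (by simpa using ht0)
      rw [hw t (by simp; linarith)] at h1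
      intro s hs
      rw [hw s hs]
      linarith
    · exact hpos
  obtain ⟨R, -, hR⟩ := (hasBasis_cobounded_norm (E := ℂ)).eventually_iff.1 hinf
  have hK : IsCompact (Metric.closedBall (0 : ℂ) R ∩ {s | 0 ≤ s.re}) :=
    (isCompact_closedBall _ _).inter_right (isClosed_le continuous_const Complex.continuous_re)
  have hcont : ContinuousOn (fun s : ℂ => (aeval s p / aeval s d).re)
      (Metric.closedBall (0 : ℂ) R ∩ {s | 0 ≤ s.re}) :=
    Complex.continuous_re.comp_continuousOn
      (analyticOnNhd_aeval_div p d fun s hs => (h s (by linarith [hs.2.out])).1).continuousOn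
  obtain ⟨δ', hδ', hcpt⟩ := hK.exists_forall_le' (a := (0 : ℝ)) hcont
    fun s hs => hpos s (by linarith [hs.2.out])
  refine ⟨min δ δ', lt_min hδ hδ', fun s hs => ?_⟩
  rcases le_total R ‖s‖ with hsR | hsR
  · exact (min_le_left _ _).trans (hR hsR hs)
  · exact (min_le_right _ _).trans (hcpt s ⟨by simpa using hsR, hs⟩)

/-- A proper rational function without poles in the closed right half plane is bounded there. -/
lemma exists_norm_aeval_div_le {p d : Polynomial ℝ} (hdeg : p.degree ≤ d.degree)
    (hd : ∀ s : ℂ, 0 ≤ s.re → aeval s d ≠ 0) :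
    ∃ M, ∀ s : ℂ, 0 ≤ s.re → ‖aeval s p / aeval s d‖ ≤ M := by
  obtain ⟨M, hM⟩ := (isBigO_aeval_cobounded hdeg).bound
  obtain ⟨R, -, hR⟩ := (hasBasis_cobounded_norm (E := ℂ)).eventually_iff.1 hM
  have hK : IsCompact (Metric.closedBall (0 : ℂ) R ∩ {s | 0 ≤ s.re}) :=
    (isCompact_closedBall _ _).inter_right (isClosed_le continuous_const Complex.continuous_re)
  obtain ⟨M', hM'⟩ := hK.exists_bound_of_continuousOn
    (analyticOnNhd_aeval_div p d fun s hs => hd s hs.2).continuousOn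
  refine ⟨max M M', fun s hs => ?_⟩
  rcases le_total R ‖s‖ with hsR | hsR
  · refine le_trans ?_ (le_max_left _ _)
    rw [norm_div, div_le_iff₀ (norm_pos_iff.2 (hd s hs))]
    exact hR hsR
  · exact (hM' s ⟨by simpa using hsR, hs⟩).trans (le_max_right _ _)

lemma Complex.re_inv_nonneg_iff {z : ℂ} : 0 ≤ z⁻¹.re ↔ 0 ≤ z.re := by
  rcases eq_or_ne z 0 with rfl | hz
  · simp
  · rw [Complex.inv_re, le_div_iff₀ (Complex.normSq_pos.2 hz), zero_mul]

/-- A nonzero rational function with nonnegative real part has no zeros in the open right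
half plane. -/
lemma aeval_ne_zero_of_re_div_nonneg {p d : Polynomial ℝ} (hp : p ≠ 0)
    (h : ∀ s : ℂ, 0 < s.re → aeval s d ≠ 0 ∧ 0 ≤ (aeval s p / aeval s d).re)
    {s : ℂ} (hs : 0 < s.re) : aeval s p ≠ 0 := by
  intro hzero
  rcases eqOn_const_or_re_pos (U := {s : ℂ | 0 < s.re})
    (analyticOnNhd_aeval_div p d fun s hs => (h s hs).1)
    (convex_halfSpace_re_gt _).isPreconnected (isOpen_lt continuous_const Complex.continuous_re)
    (fun s hs => (h s hs).2) with ⟨w, hw⟩ | hpos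
  · have hw0 : w = 0 := by rw [← hw s hs, hzero, zero_div]
    refine hp (eq_zero_of_infinite_isRoot p ((Set.Ioi_infinite (0 : ℝ)).mono fun t ht => ?_))
    have ht' : 0 < (t : ℂ).re := by simpa using ht
    have h1 := hw t ht'
    rw [hw0, div_eq_zero_iff, or_iff_left (h t ht').1] at h1
    have h2 : aeval (algebraMap ℝ ℂ t) p = 0 := h1
    rw [aeval_algebraMap_apply_eq_algebraMap_eval] at h2
    simpa using h2
  · simpa [hzero] using hpos s hs

/-- Let `m ≥ 1`, let `x 1, …, x m ∈ ℂ` be distinct, in the open left half plane, and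
closed under conjugation (so `η = ∏ j (X - x j)` has real coefficients, witnessed by
`ηr ∈ ℝ[X]`), let `d ∈ ℝ[X]` of degree at most `m` be such that `(η, d)` is strictly
positive real, and let `ν̂ ∈ ℝ[X]` with `deg ν̂ ≤ deg d` and `deg ν̂ ≤ m - 1`.  With
`r̲̂ = sup { -Re (ν̂(s)/d(s)) / Re (η(s)/d(s)) : Re s > 0 }`, for every real `r̂` with
`ν̂ + r̂·η ≠ 0`, the reciprocal rational function `d/(ν̂ + r̂·η)` is positive real
(i.e. `ν̂(s) + r̂·η(s) ≠ 0` and `Re (d(s)/(ν̂(s) + r̂·η(s))) ≥ 0` on the open right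
half plane) if and only if `r̂ ≥ r̲̂`. -/
theorem statement18 (m : ℕ) (hm : 1 ≤ m) (x : Fin m → ℂ) (hx : Function.Injective x)
    (hre : ∀ j, (x j).re < 0)
    (σ : Fin m → Fin m) (hσ : ∀ j, x (σ j) = starRingEnd ℂ (x j))
    (ηr : Polynomial ℝ) (hηr : ηr.map (algebraMap ℝ ℂ) = ∏ j, (X - C (x j)))
    (d : Polynomial ℝ) (hd : d.degree ≤ (m : ℕ))
    (hspr : IsStrictPosReal ηr d)
    (νhat : Polynomial ℝ) (hν : νhat.degree ≤ d.degree)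
    (hν' : νhat.degree ≤ ((m - 1 : ℕ) : WithBot ℕ)) :
    ∀ rhat : ℝ, νhat + C rhat * ηr ≠ 0 →
      ((∀ s : ℂ, 0 < s.re →
          (Polynomial.aeval s) νhat + (rhat : ℂ) * (Polynomial.aeval s) ηr ≠ 0 ∧
          0 ≤ ((Polynomial.aeval s) d /
            ((Polynomial.aeval s) νhat + (rhat : ℂ) * (Polynomial.aeval s) ηr)).re) ↔
        sSup { t : ℝ | ∃ s : ℂ, 0 < s.re ∧
          t = -((Polynomial.aeval s) νhat / (Polynomial.aeval s) d).re /
            ((Polynomial.aeval s) ηr / (Polynomial.aeval s) d).re } ≤ rhat) := by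
  intro rhat hne
  have hdeg : d.degree ≤ ηr.degree := by
    rw [← degree_map_eq_of_injective (algebraMap ℝ ℂ).injective ηr, hηr, degree_prod]
    simpa using hd
  obtain ⟨δ, hδ, hη⟩ := hspr.exists_le_re hdeg
  have hd0 : ∀ s : ℂ, 0 ≤ s.re → aeval s d ≠ 0 := by
    obtain ⟨ε, hε, h⟩ := hspr
    exact fun s hs => (h s (by linarith)).1
  obtain ⟨M, hM⟩ := exists_norm_aeval_div_le hν hd0
  set f : ℂ → ℝ := fun s => (aeval s ηr / aeval s d).re
  set g : ℂ → ℝ := fun s => (aeval s νhat / aeval s d).re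
  have hf0 : ∀ s : ℂ, 0 < s.re → 0 < f s := fun s hs => hδ.trans_le (hη s hs.le)
  have hbdd : BddAbove { t : ℝ | ∃ s : ℂ, 0 < s.re ∧ t = -g s / f s } := by
    refine ⟨M / δ, ?_⟩
    rintro _ ⟨s, hs, rfl⟩
    have hgM : |g s| ≤ M := (Complex.abs_re_le_norm _).trans (hM s hs.le)
    exact div_le_div₀ ((abs_nonneg _).trans hgM) ((neg_le_abs _).trans hgM) hδ (hη s hs.le)
  have hsup : sSup { t : ℝ | ∃ s : ℂ, 0 < s.re ∧ t = -g s / f s } ≤ rhat ↔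
      ∀ s : ℂ, 0 < s.re → 0 ≤ g s + rhat * f s := by
    rw [csSup_le_iff hbdd ⟨_, 1, by simp, rfl⟩]
    constructor
    · intro h s hs
      have := h _ ⟨s, hs, rfl⟩
      rw [div_le_iff₀ (hf0 s hs)] at this
      linarith
    · rintro h _ ⟨s, hs, rfl⟩
      rw [div_le_iff₀ (hf0 s hs)]
      linarith [h s hs]
  have haeval : ∀ s : ℂ, aeval s νhat + (rhat : ℂ) * aeval s ηr = aeval s (νhat + C rhat * ηr) := by
    intro s
    simp
  have hre : ∀ s : ℂ, (aeval s (νhat + C rhat * ηr) / aeval s d).re = g s + rhat * f s := by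
    intro s
    rw [← haeval, add_div, mul_div_assoc, Complex.add_re, Complex.re_ofReal_mul]
  rw [hsup]
  simp only [haeval, ← hre]
  constructor
  · intro h s hs
    rw [← Complex.re_inv_nonneg_iff, inv_div]
    exact (h s hs).2
  · intro h s hs
    refine ⟨aeval_ne_zero_of_re_div_nonneg hne (fun s hs => ⟨hd0 s hs.le, h s hs⟩) hs, ?_⟩
    rw [← Complex.re_inv_nonneg_iff, inv_div]
    exact h s hs
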